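/- For every 1 ≤ i ≤ s, the neighbor pair (i, i+1) has a weak deviation from the Lower Equilibrium of the GSP auction: for any bid b'_{i+1} with b^L_{i+2} < b'_{i+1} < b^L_{i+1}, when all bidders other than i+1 bid their LE bids and bidder i+1 bids b'_{i+1}, every bidder is allocated the same slot as under b^L, the utility of bidder i+1 is unchanged, and the utility of bidder i strictly increases (by x_i·(b^L_{i+1} − b'_{i+1}) > 0). -/

import Mathlib

/-- The rank (slot) of bidder `i` among bidders `{1,…,n}` with pairwise distinct bids
`b` in the GSP auction: one plus the number of strictly higher bids. -/
noncomputable def gspRank (n : ℕ) (b : ℕ → ℝ) (i : ℕ) : ℕ :=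
  ((Finset.Icc 1 n).filter (fun j => b i < b j)).card + 1

/-- In the GSP auction with `n` bidders and pairwise distinct bids `b`, the bidder with
the `r`-th highest bid is allocated slot `r` (with click-through rate `x r`, where
`x r = 0` for `r > s`) and pays per click the `(r+1)`-th highest bid, i.e. the highest
bid strictly below her own (`0` if there is none). `gspUtil n x v b i` is the resulting
utility of bidder `i`. -/
noncomputable def gspUtil (n : ℕ) (x v : ℕ → ℝ) (b : ℕ → ℝ) (i : ℕ) : ℝ :=
  (v i - (if h : ((Finset.Icc 1 n).filter (fun j => b j < b i)).Nonempty
            then ((Finset.Icc 1 n).filter (fun j => b j < b i)).sup' h b else 0)) *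
    x (gspRank n b i)

theorem gsp_aux_lt (n : ℕ) (b : ℕ → ℝ) (h : ∀ j, 1 ≤ j → j < n → b (j + 1) < b j)
    (j k : ℕ) (hj : 1 ≤ j) (hjk : j < k) (hk : k ≤ n) : b k < b j := by
  induction k, hjk using Nat.le_induction with
  | base => exact h j hj (by omega)
  | succ k hk' ih =>
    have h1 := ih (by omega)
    have h2 := h k (by omega) (by omega)
    linarith

theorem gsp_aux_iff (n : ℕ) (b : ℕ → ℝ) (h : ∀ j, 1 ≤ j → j < n → b (j + 1) < b j)
    (j k : ℕ) (hj : 1 ≤ j) (hjn : j ≤ n) (hk1 : 1 ≤ k) (hk : k ≤ n) : b k < b j ↔ j < k := by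
  constructor
  · intro hlt
    by_contra hc
    rcases Nat.lt_or_ge k j with h1 | h1
    · have := gsp_aux_lt n b h k j hk1 h1 hjn
      linarith
    · have : j = k := by omega
      subst this
      exact lt_irrefl _ hlt
  · intro hjk
    exact gsp_aux_lt n b h j k hj hjk hk

theorem gsp_aux_rank (n : ℕ) (b : ℕ → ℝ) (h : ∀ j, 1 ≤ j → j < n → b (j + 1) < b j)
    (t : ℕ) (ht : 1 ≤ t) (htn : t ≤ n) : gspRank n b t = t := by
  have : (Finset.Icc 1 n).filter (fun j => b t < b j) = Finset.Icc 1 (t - 1) := by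
    ext j
    simp only [Finset.mem_filter, Finset.mem_Icc]
    constructor
    · rintro ⟨⟨h1, h2⟩, h3⟩
      rw [gsp_aux_iff n b h j t h1 h2 ht htn] at h3
      omega
    · rintro ⟨h1, h2⟩
      exact ⟨⟨h1, by omega⟩, gsp_aux_lt n b h j t h1 (by omega) htn⟩
  unfold gspRank
  rw [this, Nat.card_Icc]
  omega

theorem gsp_aux_util (n : ℕ) (x v b : ℕ → ℝ) (h : ∀ j, 1 ≤ j → j < n → b (j + 1) < b j)
    (t : ℕ) (ht : 1 ≤ t) (htn : t < n) : gspUtil n x v b t = (v t - b (t + 1)) * x t := by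
  have hmem : t + 1 ∈ (Finset.Icc 1 n).filter (fun j => b j < b t) := by
    simp only [Finset.mem_filter, Finset.mem_Icc]
    exact ⟨⟨by omega, by omega⟩, h t ht htn⟩
  unfold gspUtil
  rw [gsp_aux_rank n b h t ht htn.le, dif_pos ⟨_, hmem⟩]
  congr 2
  apply le_antisymm
  · apply Finset.sup'_le
    intro j hj
    simp only [Finset.mem_filter, Finset.mem_Icc] at hj
    obtain ⟨⟨h1, h2⟩, h3⟩ := hj
    rw [gsp_aux_iff n b h t j ht htn.le h1 h2] at h3
    rcases Nat.lt_or_ge (t + 1) j with h4 | h4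
    · exact (gsp_aux_lt n b h (t + 1) j (by omega) h4 h2).le
    · have : j = t + 1 := by omega
      rw [this]
  · exact Finset.le_sup' b hmem

/-- For every `1 ≤ i ≤ s`, the neighbor pair `(i, i+1)` has a weak deviation from the
Lower Equilibrium of GSP: if bidder `i+1` lowers her bid to any `b''` with
`b^L_{i+2} < b'' < b^L_{i+1}` (all other bidders bidding their LE bids), then every
bidder keeps her slot, the utility of bidder `i+1` is unchanged, and the utility of
bidder `i` strictly increases, by `x_i·(b^L_{i+1} − b'') > 0`. -/
theorem gsp_lowerEquilibrium_neighbor_pair_weak_deviation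
    (s n : ℕ) (x v bL : ℕ → ℝ)
    (hs : 1 ≤ s) (hn : s + 2 ≤ n)
    (hxdec : ∀ j, 1 ≤ j → j < s → x (j + 1) < x j)
    (hxpos : 0 < x s)
    (hx0 : ∀ j, s < j → x j = 0)
    (hvdec : ∀ i, 1 ≤ i → i < n → v (i + 1) < v i)
    (hvpos : 0 < v n)
    (hbL1 : bL 1 = v 1)
    (hbLmid : ∀ i, 2 ≤ i → i ≤ s + 1 →
      bL i * x (i - 1) = ∑ t ∈ Finset.Icc i (s + 1), v t * (x (t - 1) - x t))
    (hbLhi : ∀ i, s + 1 < i → bL i = v i)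
    (i : ℕ) (hi1 : 1 ≤ i) (his : i ≤ s)
    (b'' : ℝ) (hlo : bL (i + 2) < b'') (hhi : b'' < bL (i + 1)) :
    (∀ t ∈ Finset.Icc 1 n,
        gspRank n (Function.update bL (i + 1) b'') t = gspRank n bL t) ∧
    gspUtil n x v (Function.update bL (i + 1) b'') (i + 1) = gspUtil n x v bL (i + 1) ∧
    gspUtil n x v (Function.update bL (i + 1) b'') i =
      gspUtil n x v bL i + x i * (bL (i + 1) - b'') ∧
    0 < x i * (bL (i + 1) - b'') := by
  have hxp : ∀ j, 1 ≤ j → j ≤ s → 0 < x j := by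
    intro j h1 h2
    induction h2 using Nat.decreasingInduction with
    | self => exact hxpos
    | of_succ k hk ih => exact (ih (by omega)).trans (hxdec k h1 hk)
  have hlast : bL (s + 1) = v (s + 1) := by
    have h := hbLmid (s + 1) (by omega) le_rfl
    rw [Finset.Icc_self, Finset.sum_singleton, hx0 (s + 1) (by omega), Nat.add_sub_cancel,
      sub_zero] at h
    exact mul_right_cancel₀ hxpos.ne' h
  have hrec : ∀ j, 2 ≤ j → j ≤ s → bL j * x (j - 1) = v j * (x (j - 1) - x j) + bL (j + 1) * x j := by
    intro j h1 h2
    have h3 := hbLmid (j + 1) (by omega) (by omega)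
    rw [Nat.add_sub_cancel] at h3
    rw [hbLmid j h1 (by omega), h3, ← Finset.add_sum_Ioc_eq_sum_Icc (by omega : j ≤ s + 1)]
    congr 2
    ext t
    simp only [Finset.mem_Ioc, Finset.mem_Icc]
    omega
  have hstep : ∀ j, 2 ≤ j → j ≤ s → bL (j + 1) ≤ v (j + 1) → bL j ≤ v j ∧ bL (j + 1) < bL j := by
    intro j h1 h2 h3
    have hv := hvdec j (by omega) (by omega)
    have hx1 := hxdec (j - 1) (by omega) (by omega)
    rw [Nat.sub_add_cancel (by omega : 1 ≤ j)] at hx1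
    have hp := hxp j (by omega) h2
    have hr := hrec j h1 h2
    have hp' : 0 < x (j - 1) := hp.trans hx1
    constructor
    · refine le_of_mul_le_mul_right ?_ hp'
      nlinarith
    · refine lt_of_mul_lt_mul_right ?_ hp'.le
      nlinarith
  have hle : ∀ j, 2 ≤ j → j ≤ s + 1 → bL j ≤ v j := by
    intro j h1 h2
    induction h2 using Nat.decreasingInduction with
    | self => exact hlast.le
    | of_succ k hk ih => exact (hstep k h1 (by omega) (ih (by omega))).1
  have hdec : ∀ j, 1 ≤ j → j < n → bL (j + 1) < bL j := by
    intro j h1 h2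
    have hv := hvdec j h1 h2
    rcases Nat.lt_or_ge s j with h3 | h3
    · rw [hbLhi (j + 1) (by omega)]
      rcases Nat.lt_or_ge (s + 1) j with h4 | h4
      · rw [hbLhi j h4]; exact hv
      · have : j = s + 1 := by omega
        subst this
        rw [hlast]; exact hv
    · have h4 := hle (j + 1) (by omega) (by omega)
      rcases Nat.lt_or_ge 1 j with h5 | h5
      · exact (hstep j h5 h3 h4).2
      · have : j = 1 := by omega
        subst this
        rw [hbL1]; linarith
  have hdec' : ∀ j, 1 ≤ j → j < n →
      Function.update bL (i + 1) b'' (j + 1) < Function.update bL (i + 1) b'' j := by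
    intro j h1 h2
    have hd := hdec j h1 h2
    by_cases h3 : j = i
    · subst h3
      rw [Function.update_self, Function.update_of_ne (by omega)]
      linarith
    · by_cases h4 : j = i + 1
      · subst h4
        rw [Function.update_self, Function.update_of_ne (by omega)]
        exact hlo
      · rw [Function.update_of_ne (by omega), Function.update_of_ne (by omega)]
        exact hd
  refine ⟨?_, ?_, ?_, ?_⟩
  · intro t ht
    rw [Finset.mem_Icc] at ht
    rw [gsp_aux_rank n _ hdec' t ht.1 ht.2, gsp_aux_rank n _ hdec t ht.1 ht.2]
  · rw [gsp_aux_util n x v _ hdec' (i + 1) (by omega) (by omega),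
      gsp_aux_util n x v _ hdec (i + 1) (by omega) (by omega),
      Function.update_of_ne (by omega)]
  · rw [gsp_aux_util n x v _ hdec' i (by omega) (by omega),
      gsp_aux_util n x v _ hdec i (by omega) (by omega),
      Function.update_self]
    ring
  · exact mul_pos (hxp i hi1 his) (by linarith)
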